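/- Let x be a rational number with |x| < 1/(a + b√m). Then F⁻(x) := bx/(1−2ax−x²) is an integer if and only if x = F⁻_{2n}/F⁻_{2n+1} for some n ≥ 0. -/

import Mathlib

/-- `Lm a n` : L⁻_0 = 1, L⁻_1 = a, L⁻_{n+2} = 2a L⁻_{n+1} + L⁻_n. -/
def Lm (a : ℤ) : ℕ → ℤ
  | 0 => 1
  | 1 => a
  | n + 2 => 2 * a * Lm a (n + 1) + Lm a n

/-- `Fm a b n` : F⁻_0 = 0, F⁻_1 = b, F⁻_{n+2} = 2a F⁻_{n+1} + F⁻_n. -/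
def Fm (a b : ℤ) : ℕ → ℤ
  | 0 => 0
  | 1 => b
  | n + 2 => 2 * a * Fm a b (n + 1) + Fm a b n

theorem Lm_Fm_succ (m a b : ℤ) (hab : a ^ 2 - m * b ^ 2 = -1) (n : ℕ) :
    Lm a (n + 1) = a * Lm a n + m * b * Fm a b n ∧
      Fm a b (n + 1) = b * Lm a n + a * Fm a b n := by
  induction n with
  | zero => simp [Lm, Fm]
  | succ n ih =>
    obtain ⟨h1, h2⟩ := ih
    simp only [Lm, Fm] at *
    rw [h1, h2]
    constructor
    · linear_combination Lm a n * hab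
    · linear_combination Fm a b n * hab

theorem Lm_sq_sub_Fm_sq (m a b : ℤ) (hab : a ^ 2 - m * b ^ 2 = -1) (n : ℕ) :
    Lm a n ^ 2 - m * Fm a b n ^ 2 = (-1) ^ n := by
  induction n with
  | zero => simp [Lm, Fm]
  | succ n ih =>
    obtain ⟨h1, h2⟩ := Lm_Fm_succ m a b hab n
    rw [h1, h2, pow_succ (-1 : ℤ), ← ih]
    linear_combination (Lm a n ^ 2 - m * Fm a b n ^ 2) * hab

theorem Lm_Fm_two_mul (m a b : ℤ) (hab : a ^ 2 - m * b ^ 2 = -1) (n : ℕ) :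
    Lm a (2 * n) = Lm a n ^ 2 + m * Fm a b n ^ 2 ∧
      Fm a b (2 * n) = 2 * Lm a n * Fm a b n := by
  induction n with
  | zero => simp [Lm, Fm]
  | succ n ih =>
    obtain ⟨h1, h2⟩ := Lm_Fm_succ m a b hab n
    obtain ⟨h3, h4⟩ := Lm_Fm_succ m a b hab (2 * n)
    obtain ⟨h5, h6⟩ := Lm_Fm_succ m a b hab (2 * n + 1)
    obtain ⟨h7, h8⟩ := ih
    rw [show 2 * (n + 1) = 2 * n + 1 + 1 by ring, h5, h6, h3, h4, h7, h8, h1, h2]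
    constructor <;> ring

theorem Lm_two_mul_add_one (m a b : ℤ) (hab : a ^ 2 - m * b ^ 2 = -1) (n : ℕ) :
    Lm a (2 * n + 1) = (-1) ^ n * a + 2 * m * (Fm a b n * Fm a b (n + 1)) := by
  obtain ⟨-, h2⟩ := Lm_Fm_succ m a b hab n
  obtain ⟨h3, -⟩ := Lm_Fm_succ m a b hab (2 * n)
  obtain ⟨h7, h8⟩ := Lm_Fm_two_mul m a b hab n
  rw [h3, h7, h8, h2, ← Lm_sq_sub_Fm_sq m a b hab n]
  ring

theorem Fm_quadratic (m a b : ℤ) (hab : a ^ 2 - m * b ^ 2 = -1) (n : ℕ) :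
    Fm a b (n + 1) ^ 2 - 2 * a * Fm a b n * Fm a b (n + 1) - Fm a b n ^ 2
      = (-1) ^ n * b ^ 2 := by
  obtain ⟨-, h2⟩ := Lm_Fm_succ m a b hab n
  rw [h2, ← Lm_sq_sub_Fm_sq m a b hab n]
  linear_combination (-Fm a b n ^ 2) * hab

theorem dvd_Fm (a b : ℤ) (n : ℕ) : b ∣ Fm a b n ∧ b ∣ Fm a b (n + 1) := by
  induction n with
  | zero => simp [Fm]
  | succ n ih => exact ⟨ih.2, dvd_add (ih.2.mul_left _) ih.1⟩

theorem Fm_nonneg_le_succ (a b : ℤ) (ha : 0 < a) (hb : 0 < b) (n : ℕ) :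
    0 ≤ Fm a b n ∧ Fm a b n ≤ Fm a b (n + 1) ∧ 0 < Fm a b (n + 1) := by
  induction n with
  | zero => simp [Fm, hb, hb.le]
  | succ n ih =>
    obtain ⟨h1, h2, h3⟩ := ih
    have h4 : Fm a b (n + 1) ≤ Fm a b (n + 1 + 1) := by
      simp only [Fm] at *
      nlinarith
    exact ⟨h3.le, h4, h3.trans_le h4⟩

/-- Every positive solution of `x ^ 2 - m * y ^ 2 = ±1` comes from a power of the minimal one. -/
theorem exists_eq_Lm_Fm (m a b : ℤ) (hm : 0 < m)
    (ha : 0 < a) (hb : 0 < b) (hab : a ^ 2 - m * b ^ 2 = -1)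
    (hmin : ∀ x y : ℤ, 0 < x → 0 < y →
      (x ^ 2 - m * y ^ 2 = 1 ∨ x ^ 2 - m * y ^ 2 = -1) → a ≤ x ∧ b ≤ y)
    (N : ℕ) : ∀ x y : ℤ, y.toNat ≤ N → 0 < x → 0 < y →
      (x ^ 2 - m * y ^ 2 = 1 ∨ x ^ 2 - m * y ^ 2 = -1) →
      ∃ n : ℕ, x = Lm a n ∧ y = Fm a b n := by
  induction N with
  | zero => intro x y h1 h2 h3; omega
  | succ N ih =>
    intro x y hN hx hy h
    obtain ⟨hax, hby⟩ := hmin x y hx hy h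
    have hby2 : b ^ 2 ≤ y ^ 2 := by gcongr
    have hmby2 : m * b ^ 2 ≤ m * y ^ 2 := by gcongr
    have hx2 : x = a ∧ y = b ∨ a + 1 ≤ x := by
      rcases hax.lt_or_eq with h1 | h1
      · right; omega
      · subst h1
        left
        refine ⟨rfl, ?_⟩
        rcases h with h | h
        · omega
        · have h3 : m * (y ^ 2 - b ^ 2) = 0 := by linarith
          have h4 : y ^ 2 = b ^ 2 := by
            rcases mul_eq_zero.1 h3 with h5 | h5
            · omega
            · linarith
          exact (pow_left_inj₀ hy.le hb.le two_ne_zero).1 h4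
    rcases hx2 with ⟨rfl, rfl⟩ | hx1
    · exact ⟨1, rfl, rfl⟩
    have hx1' : (a + 1) ^ 2 ≤ x ^ 2 := by gcongr
    obtain ⟨e, he, he1, he2⟩ : ∃ e : ℤ, x ^ 2 - m * y ^ 2 = e ∧ -1 ≤ e ∧ e ≤ 1 := by
      rcases h with h | h <;> exact ⟨_, h, by norm_num, by norm_num⟩
    have hX : a * x < m * b * y := by
      apply lt_of_pow_lt_pow_left₀ 2 (by positivity)
      have : (m * b * y) ^ 2 = (a ^ 2 + 1) * (x ^ 2 - e) := by
        linear_combination (-m * y ^ 2) * hab - (a ^ 2 + 1) * he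
      rw [this]
      nlinarith
    have hY : a * y ≤ b * x := by
      refine (pow_le_pow_iff_left₀ (by positivity) (by positivity) two_ne_zero).1 ?_
      have : (b * x) ^ 2 = (a ^ 2 + 1) * y ^ 2 + e * b ^ 2 := by
        linear_combination b ^ 2 * he - y ^ 2 * hab
      rw [this]
      nlinarith
    have hY' : b * x < (a + 1) * y := by
      apply lt_of_pow_lt_pow_left₀ 2 (by positivity)
      have : (b * x) ^ 2 = (a ^ 2 + 1) * y ^ 2 + e * b ^ 2 := by
        linear_combination b ^ 2 * he - y ^ 2 * hab
      rw [this]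
      nlinarith [mul_pos ha (pow_pos hy 2), pow_pos hb 2]
    have hnorm : (m * b * y - a * x) ^ 2 - m * (b * x - a * y) ^ 2 = 1 ∨
        (m * b * y - a * x) ^ 2 - m * (b * x - a * y) ^ 2 = -1 := by
      have : (m * b * y - a * x) ^ 2 - m * (b * x - a * y) ^ 2 = -(x ^ 2 - m * y ^ 2) := by
        linear_combination (x ^ 2 - m * y ^ 2) * hab
      rw [this]
      omega
    have hback1 : x = a * (m * b * y - a * x) + m * b * (b * x - a * y) := by
      linear_combination x * hab
    have hback2 : y = b * (m * b * y - a * x) + a * (b * x - a * y) := by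
      linear_combination y * hab
    suffices ∃ n : ℕ, m * b * y - a * x = Lm a n ∧ b * x - a * y = Fm a b n by
      obtain ⟨n, h1, h2⟩ := this
      obtain ⟨h3, h4⟩ := Lm_Fm_succ m a b hab n
      exact ⟨n + 1, by rw [h3, ← h1, ← h2]; exact hback1, by rw [h4, ← h1, ← h2]; exact hback2⟩
    rcases hY.lt_or_eq with h1 | h1
    · refine ih _ _ ?_ (by linarith) (by linarith) hnorm
      have : b * x - a * y < y := by linarith
      omega
    · refine ⟨0, ?_, by simp [Fm, h1]⟩
      have h0 : b * x - a * y = 0 := by linarith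
      rw [h0] at hnorm
      simp only [Lm]
      have : 0 < m * b * y - a * x := by linarith
      rcases hnorm with h2 | h2 <;> nlinarith

theorem not_two_mul_eq_two_mul_mul (m a b : ℤ) (hm : 0 < m) (hns : ¬ IsSquare m)
    (hab : a ^ 2 - m * b ^ 2 = -1) (c : ℤ) : 2 * a ≠ 2 * (m * c) := by
  intro h
  have h1 : a = m * c := by linarith
  have h2 : m ∣ 1 := ⟨b ^ 2 - a * c, by linear_combination hab - a * h1⟩
  have h3 : m = 1 := Int.eq_one_of_dvd_one hm.le h2
  exact hns (h3 ▸ ⟨1, rfl⟩)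

theorem abs_lt_one_and_denominator_pos (m a b : ℤ) (hm : 0 < m)
    (ha : 0 < a) (hb : 0 < b) (hab : a ^ 2 - m * b ^ 2 = -1)
    (x : ℚ) (hconv : |(x : ℝ)| < 1 / ((a : ℝ) + (b : ℝ) * Real.sqrt (m : ℝ))) :
    |x| < 1 ∧ 0 < 1 - 2 * (a : ℚ) * x - x ^ 2 := by
  have hs : Real.sqrt (m : ℝ) ^ 2 = m := Real.sq_sqrt (by exact_mod_cast hm.le)
  have hspos : 0 < Real.sqrt (m : ℝ) := Real.sqrt_pos.2 (by exact_mod_cast hm)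
  have haR : (1 : ℝ) ≤ a := by exact_mod_cast ha
  have hbR : (0 : ℝ) < b := by exact_mod_cast hb
  have habR : (a : ℝ) ^ 2 - m * b ^ 2 = -1 := by exact_mod_cast hab
  set s := Real.sqrt (m : ℝ)
  have hbs : 0 < b * s := by positivity
  have hα : 1 < a + b * s := by linarith
  have hprod : (a + b * s) * (b * s - a) = 1 := by
    linear_combination (b : ℝ) ^ 2 * hs - habR
  have hβ : 0 < b * s - a := by
    by_contra! h
    nlinarith
  have hβ1 : b * s - a < 1 := by nlinarith
  rw [lt_div_iff₀ (by linarith)] at hconv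
  have hx0 := abs_nonneg (x : ℝ)
  have hx1 : |(x : ℝ)| < 1 := by nlinarith
  have hle := le_abs_self (x : ℝ)
  have hge := neg_abs_le (x : ℝ)
  refine ⟨by exact_mod_cast hx1, ?_⟩
  have h1 : 0 < 1 - (a + b * s) * x := by nlinarith
  have h2 : 0 < 1 + (b * s - a) * x := by nlinarith
  have h3 : (0 : ℝ) < 1 - 2 * a * x - x ^ 2 := by
    have : (1 : ℝ) - 2 * a * x - x ^ 2 = (1 - (a + b * s) * x) * (1 + (b * s - a) * x) := by
      linear_combination (x : ℝ) ^ 2 * hprod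
    rw [this]
    positivity
  exact_mod_cast h3

theorem exists_odd_index (m a b : ℤ) (hm : 0 < m)
    (ha : 0 < a) (hb : 0 < b) (hab : a ^ 2 - m * b ^ 2 = -1)
    (hmin : ∀ x y : ℤ, 0 < x → 0 < y →
      (x ^ 2 - m * y ^ 2 = 1 ∨ x ^ 2 - m * y ^ 2 = -1) → a ≤ x ∧ b ≤ y)
    (x y : ℤ) (hx : 0 < x) (h : x ^ 2 - m * y ^ 2 = -1) :
    ∃ n : ℕ, x = (-1) ^ n * a + 2 * m * (Fm a b n * Fm a b (n + 1)) := by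
  have hy : y ≠ 0 := by
    rintro rfl
    nlinarith
  obtain ⟨n, h1, h2⟩ := exists_eq_Lm_Fm m a b hm ha hb hab hmin _ x |y| le_rfl hx
    (abs_pos.2 hy) (Or.inr (by rw [sq_abs]; exact h))
  have h3 := Lm_sq_sub_Fm_sq m a b hab n
  rw [← h1, ← h2, sq_abs, h] at h3
  rcases n.even_or_odd' with ⟨t, rfl | rfl⟩
  · rw [pow_mul] at h3
    norm_num at h3
  · exact ⟨t, h1.trans (Lm_two_mul_add_one m a b hab t)⟩

theorem eq_div_of_quadratic_root {p q x : ℚ} (hp : 0 ≤ p) (hpq : p ≤ q) (hq : 0 < q)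
    (hx : |x| < 1) (h : p * q * x ^ 2 + (q ^ 2 - p ^ 2) * x - p * q = 0) : x = p / q := by
  have h1 : (q * x - p) * (p * x + q) = 0 := by linear_combination h
  have h2 : 0 < p * x + q := by
    have := (abs_lt.1 hx).1
    rcases hp.lt_or_eq with h3 | h3
    · nlinarith
    · rw [← h3]; linarith
  rcases mul_eq_zero.1 h1 with h3 | h3
  · rw [eq_div_iff hq.ne']
    linarith
  · linarith

theorem F_minus_int_iff_conv (m a b : ℤ) (hm : 0 < m) (hns : ¬ IsSquare m)
    (ha : 0 < a) (hb : 0 < b) (hab : a ^ 2 - m * b ^ 2 = -1)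
    (hmin : ∀ x y : ℤ, 0 < x → 0 < y →
      (x ^ 2 - m * y ^ 2 = 1 ∨ x ^ 2 - m * y ^ 2 = -1) → a ≤ x ∧ b ≤ y)
    (x : ℚ) (hconv : |(x : ℝ)| < 1 / ((a : ℝ) + (b : ℝ) * Real.sqrt (m : ℝ))) :
    (∃ k : ℤ, ((b : ℚ) * x) / (1 - 2 * (a : ℚ) * x - x ^ 2) = (k : ℚ)) ↔
      (∃ n : ℕ, x = (Fm a b (2 * n) : ℚ) / (Fm a b (2 * n + 1) : ℚ)) := by
  obtain ⟨hx1, hden⟩ := abs_lt_one_and_denominator_pos m a b hm ha hb hab x hconv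
  have hbQ : (b : ℚ) ≠ 0 := by exact_mod_cast hb.ne'
  constructor
  · rintro ⟨k, hk⟩
    rw [div_eq_iff hden.ne'] at hk
    obtain ⟨d, hd⟩ : IsSquare ((2 * a * k + b) ^ 2 + 4 * k ^ 2) := by
      rw [← Rat.isSquare_intCast_iff]
      refine ⟨2 * k * x + (2 * a * k + b), ?_⟩
      push_cast
      linear_combination (-4 * k : ℚ) * hk
    have hpell : (2 * m * b * k + a) ^ 2 - m * d ^ 2 = -1 := by
      linear_combination m * hd + (1 - 4 * m * k ^ 2) * hab
    have hroot : ∀ n : ℕ, ((b * k : ℤ) : ℚ) = (-1) ^ n * ((Fm a b n * Fm a b (n + 1) : ℤ) : ℚ) →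
        x = (Fm a b n : ℚ) / (Fm a b (n + 1) : ℚ) := by
      intro n hn
      obtain ⟨h1, h2, h3⟩ := Fm_nonneg_le_succ a b ha hb n
      have hq : (Fm a b (n + 1) ^ 2 - 2 * a * Fm a b n * Fm a b (n + 1) - Fm a b n ^ 2 : ℚ)
          = (-1) ^ n * b ^ 2 := by exact_mod_cast Fm_quadratic m a b hab n
      apply eq_div_of_quadratic_root (by exact_mod_cast h1) (by exact_mod_cast h2)
        (by exact_mod_cast h3) hx1
      push_cast at hn
      rcases neg_one_pow_eq_or ℚ n with h | h <;> rw [h] at hn hq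
      · linear_combination (b : ℚ) * hk - (x ^ 2 + 2 * a * x - 1) * hn + x * hq
      · linear_combination (-b : ℚ) * hk + (x ^ 2 + 2 * a * x - 1) * hn + x * hq
    have hkey : ∃ n : ℕ, b * k = (-1) ^ n * (Fm a b n * Fm a b (n + 1)) := by
      rcases lt_trichotomy (2 * m * b * k + a) 0 with hX | hX | hX
      · obtain ⟨n, hn⟩ := exists_odd_index m a b hm ha hb hab hmin (-(2 * m * b * k + a)) d
          (by linarith) (by rw [neg_sq]; exact hpell)
        refine ⟨n, ?_⟩
        rcases neg_one_pow_eq_or ℤ n with h | h <;> rw [h] at hn ⊢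
        · exact absurd (by linear_combination (-1) * hn) (not_two_mul_eq_two_mul_mul m a b hm hns hab
            (-(Fm a b n * Fm a b (n + 1)) - b * k))
        · apply mul_left_cancel₀ (mul_ne_zero two_ne_zero hm.ne')
          linear_combination (-1) * hn
      · exact absurd (by linear_combination 2 * hX)
          (not_two_mul_eq_two_mul_mul m a b hm hns hab (-(2 * b * k)))
      · obtain ⟨n, hn⟩ := exists_odd_index m a b hm ha hb hab hmin _ d hX hpell
        refine ⟨n, ?_⟩
        rcases neg_one_pow_eq_or ℤ n with h | h <;> rw [h] at hn ⊢
        · apply mul_left_cancel₀ (mul_ne_zero two_ne_zero hm.ne')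
          linear_combination hn
        · exact absurd (by linear_combination hn) (not_two_mul_eq_two_mul_mul m a b hm hns hab
            (Fm a b n * Fm a b (n + 1) - b * k))
    obtain ⟨n, hn⟩ := hkey
    have hxn := hroot n (by exact_mod_cast hn)
    rcases n.even_or_odd' with ⟨t, rfl | rfl⟩
    · exact ⟨t, hxn⟩
    · exfalso
      have h3 : (0 : ℚ) < Fm a b (2 * t + 1 + 1) := by
        exact_mod_cast (Fm_nonneg_le_succ a b ha hb (2 * t + 1)).2.2
      have hq : (Fm a b (2 * t + 1 + 1) ^ 2 - 2 * a * Fm a b (2 * t + 1) * Fm a b (2 * t + 1 + 1)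
          - Fm a b (2 * t + 1) ^ 2 : ℚ) = (-1) ^ (2 * t + 1) * b ^ 2 := by
        exact_mod_cast Fm_quadratic m a b hab (2 * t + 1)
      rw [(odd_two_mul_add_one t).neg_one_pow] at hq
      rw [eq_div_iff h3.ne'] at hxn
      rw [← hxn] at hq
      have : (Fm a b (2 * t + 1 + 1) : ℚ) ^ 2 * (1 - 2 * (a : ℚ) * x - x ^ 2) = -(b : ℚ) ^ 2 := by
        linear_combination hq
      have h4 := mul_pos (pow_pos h3 2) hden
      have h5 : (0 : ℚ) < b ^ 2 := by positivity
      linarith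
  · rintro ⟨n, hn⟩
    obtain ⟨f, hf⟩ := (dvd_Fm a b (2 * n)).1
    have h3 : (0 : ℚ) < Fm a b (2 * n + 1) := by
      exact_mod_cast (Fm_nonneg_le_succ a b ha hb (2 * n)).2.2
    have hq : (Fm a b (2 * n + 1) ^ 2 - 2 * a * Fm a b (2 * n) * Fm a b (2 * n + 1)
        - Fm a b (2 * n) ^ 2 : ℚ) = (-1) ^ (2 * n) * b ^ 2 := by
      exact_mod_cast Fm_quadratic m a b hab (2 * n)
    rw [pow_mul] at hq
    norm_num at hq
    rw [eq_div_iff h3.ne'] at hn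
    have hfQ : (Fm a b (2 * n) : ℚ) = b * f := by exact_mod_cast hf
    refine ⟨f * Fm a b (2 * n + 1), ?_⟩
    rw [div_eq_iff hden.ne']
    rw [← hn] at hq hfQ
    push_cast
    apply mul_left_cancel₀ (mul_ne_zero hbQ h3.ne')
    linear_combination (b : ℚ) ^ 2 * hfQ - (f * b : ℚ) * hq
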